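/- arXiv:2111.09345 — 2 statements merged into one kernel-verified Lean document; each statement's English description precedes it below -/
import Mathlib

section
/- Let O^{(1)}, …, O^{(n)} be real polynomials of degree at most n-1 with ∫_{a_j}^{b_j} O^{(k)}(x)/√(-T(x)) dx = π·δ_{kj} for all k, j = 1,…,n, let κ ∈ ℝ, and set Q^{(t)} = Q - κP. Then the 2n×2n real matrix 𝒳 with entries 𝒳_{k,j} = O^{(k)}(a_j)P(a_j)/T'(a_j), 𝒳_{k,n+j} = O^{(k)}(b_j)P(b_j)/T'(b_j), 𝒳_{n+k,j} = 3·O^{(k)}(a_j)Q^{(t)}(a_j)/T'(a_j), 𝒳_{n+k,n+j} = 3·O^{(k)}(b_j)Q^{(t)}(b_j)/T'(b_j) (for k, j = 1,…,n) is invertible. (This is the unique solvability of the linear system expressing arbitrary variations of the space and time KdV frequencies by variations of the gap endpoints, Theorem 4.4.) -/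
open Polynomial MeasureTheory intervalIntegral

namespace FiniteGap

/-- A polynomial without roots on a preconnected set has constant sign there. -/
lemma eval_pos_or_neg_of_ne_zero {s : Set ℝ} (hs : IsPreconnected s) {V : ℝ[X]}
    (hV : ∀ x ∈ s, V.eval x ≠ 0) :
    (∀ x ∈ s, 0 < V.eval x) ∨ (∀ x ∈ s, V.eval x < 0) := by
  by_contra! h
  obtain ⟨⟨x, hx, hx0⟩, y, hy, hy0⟩ := h
  obtain ⟨z, hz, hz0⟩ := hs.intermediate_value hx hy V.continuous.continuousOn ⟨hx0, hy0⟩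
  exact hV z hz hz0

lemma intervalIntegrable_inv_sqrt_mul {a b : ℝ} (hab : a < b) :
    IntervalIntegrable (fun x => (√((x - a) * (b - x)))⁻¹) volume a b := by
  have h1 : IntervalIntegrable (fun x : ℝ => (x - a) ^ (-(1 / 2) : ℝ)) volume a b := by
    simpa using (intervalIntegrable_rpow' (a := 0) (b := b - a)
      (r := -(1 / 2)) (by norm_num)).comp_sub_right a
  have h2 : IntervalIntegrable (fun x : ℝ => (b - x) ^ (-(1 / 2) : ℝ)) volume a b := by
    simpa using (intervalIntegrable_rpow' (a := b - a) (b := 0)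
      (r := -(1 / 2)) (by norm_num)).comp_sub_left b
  refine ((h1.add h2).const_mul (√(b - a))⁻¹).mono_fun
    (Measurable.aestronglyMeasurable (by fun_prop)) ?_
  rw [Set.uIoc_of_le hab.le, ← Measure.restrict_congr_set Ioo_ae_eq_Ioc]
  refine (ae_restrict_iff' measurableSet_Ioo).2 (Filter.Eventually.of_forall fun x hx => ?_)
  have hu : 0 < x - a := sub_pos.2 hx.1
  have hv : 0 < b - x := sub_pos.2 hx.2
  simp only [Real.rpow_neg hu.le, Real.rpow_neg hv.le, ← Real.sqrt_eq_rpow]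
  have hu' := Real.sqrt_pos.2 hu
  have hv' := Real.sqrt_pos.2 hv
  have hL := Real.sqrt_pos.2 (sub_pos.2 hab)
  rw [Real.norm_of_nonneg (by positivity), Real.norm_of_nonneg (by positivity),
    Real.sqrt_mul hu.le]
  have key : √(b - a) ≤ √(x - a) + √(b - x) := by
    refine Real.sqrt_le_iff.2 ⟨by positivity, ?_⟩
    nlinarith [Real.sq_sqrt hu.le, Real.sq_sqrt hv.le]
  have : (√(b - a))⁻¹ * ((√(x - a))⁻¹ + (√(b - x))⁻¹)
      = (√(x - a) * √(b - x))⁻¹ * ((√(x - a) + √(b - x)) / √(b - a)) := by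
    field_simp
    ring
  rw [this]
  exact le_mul_of_one_le_right (by positivity) ((one_le_div hL).2 key)

lemma intervalIntegrable_div_sqrt {a b : ℝ} (hab : a < b) {T S : ℝ[X]}
    (hT : T = (X - C a) * (X - C b) * S) (hS : ∀ x ∈ Set.Icc a b, 0 < S.eval x) (p : ℝ[X]) :
    IntervalIntegrable (fun x => p.eval x / √(-(T.eval x))) volume a b := by
  have hc : ContinuousOn (fun x => p.eval x / √(S.eval x)) (Set.uIcc a b) := by
    rw [Set.uIcc_of_le hab.le]
    exact p.continuous.continuousOn.div S.continuous.sqrt.continuousOn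
      fun x hx => (Real.sqrt_pos.2 (hS x hx)).ne'
  refine ((intervalIntegrable_inv_sqrt_mul hab).continuousOn_mul hc).congr ?_
  rw [Set.uIoc_of_le hab.le]
  intro x hx
  have hTx : -(T.eval x) = ((x - a) * (b - x)) * S.eval x := by
    simp [hT]; ring
  have h0 : 0 ≤ (x - a) * (b - x) := mul_nonneg (by linarith [hx.1]) (by linarith [hx.2])
  simp only [hTx, Real.sqrt_mul h0]
  rw [div_mul_eq_mul_div, div_eq_mul_inv, div_eq_mul_inv, mul_inv]
  ring

/-- A polynomial that is nonnegative on `(a, b)` has positive integral against `1 / √(-T)`. -/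
lemma integral_div_sqrt_pos {a b : ℝ} (hab : a < b) {T p : ℝ[X]}
    (hT : ∀ x ∈ Set.Ioo a b, T.eval x < 0)
    (hi : IntervalIntegrable (fun x => p.eval x / √(-(T.eval x))) volume a b)
    (hp : p ≠ 0) (hpos : ∀ x ∈ Set.Ioo a b, 0 ≤ p.eval x) :
    0 < ∫ x in a..b, p.eval x / √(-(T.eval x)) := by
  rw [integral_pos_iff_support_of_nonneg_ae' ?_ hi]
  · refine ⟨hab, ?_⟩
    have hsub : Set.Ioo a b \ {x | p.IsRoot x} ⊆
        Function.support (fun x => p.eval x / √(-(T.eval x))) ∩ Set.Ioc a b := fun x hx =>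
      ⟨div_ne_zero hx.2 (Real.sqrt_pos.2 (neg_pos.2 (hT x hx.1))).ne', hx.1.1, hx.1.2.le⟩
    refine lt_of_lt_of_le ?_ (measure_mono hsub)
    rw [measure_sdiff_null ((Polynomial.finite_setOfPred_isRoot hp).measure_zero _)]
    simpa using hab
  · rw [Set.uIoc_of_le hab.le, ← Measure.restrict_congr_set Ioo_ae_eq_Ioc]
    exact (ae_restrict_iff' measurableSet_Ioo).2 (Filter.Eventually.of_forall fun x hx =>
      div_nonneg (hpos x hx) (Real.sqrt_nonneg _))

lemma exists_root_of_integral_eq_zero {a b : ℝ} (hab : a < b) {T H V : ℝ[X]}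
    (hT : ∀ x ∈ Set.Ioo a b, T.eval x < 0)
    (hi : ∀ p : ℝ[X], IntervalIntegrable (fun x => p.eval x / √(-(T.eval x))) volume a b)
    (hH : ∀ x, 0 ≤ H.eval x) (hHV : H * V ≠ 0)
    (hint : ∫ x in a..b, (H * V).eval x / √(-(T.eval x)) = 0) :
    ∃ x ∈ Set.Ioo a b, V.eval x = 0 := by
  by_contra! h
  rcases eval_pos_or_neg_of_ne_zero isPreconnected_Ioo h with h | h
  · refine (integral_div_sqrt_pos hab hT (hi _) hHV fun x hx => ?_).ne' hint
    rw [eval_mul]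
    exact mul_nonneg (hH x) (h x hx).le
  · refine (integral_div_sqrt_pos hab hT (hi _) (neg_ne_zero.2 hHV) fun x hx => ?_).ne' ?_
    · rw [eval_neg, eval_mul, neg_nonneg]
      exact mul_nonpos_of_nonneg_of_nonpos (hH x) (h x hx).le
    · simp only [eval_neg, neg_div, intervalIntegral.integral_neg, hint, neg_zero]

/-- A linear combination of polynomials with vanishing integrals again has vanishing integrals. -/
lemma integral_combination_eq_zero {a b : ℝ} {T P Q : ℝ[X]}
    (hi : ∀ p : ℝ[X], IntervalIntegrable (fun x => p.eval x / √(-(T.eval x))) volume a b)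
    (hP : ∫ x in a..b, P.eval x / √(-(T.eval x)) = 0)
    (hQ : ∫ x in a..b, Q.eval x / √(-(T.eval x)) = 0) (α β : ℝ) :
    ∫ x in a..b, (C α * P + C β * Q).eval x / √(-(T.eval x)) = 0 := by
  have : ∀ x, (C α * P + C β * Q).eval x / √(-(T.eval x))
      = α * (P.eval x / √(-(T.eval x))) + β * (Q.eval x / √(-(T.eval x))) := by
    intro x
    simp only [eval_add, eval_mul, eval_C]
    ring
  simp only [this]
  rw [intervalIntegral.integral_add ((hi P).const_mul α) ((hi Q).const_mul β)]
  simp [hP, hQ]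

lemma injective_of_mem_gaps {n : ℕ} {a b : Fin n → ℝ}
    (hsep : ∀ j k : Fin n, j < k → b k < a j) {c : Fin n → ℝ}
    (hc : ∀ k, c k ∈ Set.Ioo (a k) (b k)) : Function.Injective c := by
  intro i j hij
  by_contra hne
  rcases lt_or_gt_of_ne hne with h | h
  · linarith [hsep _ _ h, (hc i).1, (hc j).2]
  · linarith [hsep _ _ h, (hc j).1, (hc i).2]

lemma eq_zero_of_root_in_gaps {n : ℕ} {a b : Fin n → ℝ}
    (hsep : ∀ j k : Fin n, j < k → b k < a j) {V : ℝ[X]} (hdeg : V.degree < n)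
    (hV : ∀ k, ∃ x ∈ Set.Ioo (a k) (b k), V.eval x = 0) : V = 0 := by
  choose c hc hc0 using hV
  exact eq_zero_of_degree_lt_of_eval_index_eq_zero (s := Finset.univ) (v := c)
    (injective_of_mem_gaps hsep hc).injOn (by simpa using hdeg) fun i _ => hc0 i

/-- The Wronskian of the two normalized differentials has no real zeros. -/
lemma wronskian_eval_ne_zero {n : ℕ} {a b : Fin n → ℝ} (hab : ∀ j, a j < b j)
    (hsep : ∀ j k : Fin n, j < k → b k < a j) {T P Q : ℝ[X]}
    (hT : ∀ k, ∀ x ∈ Set.Ioo (a k) (b k), T.eval x < 0)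
    (hi : ∀ k, ∀ p : ℝ[X],
      IntervalIntegrable (fun x => p.eval x / √(-(T.eval x))) volume (a k) (b k))
    (hPmonic : P.Monic) (hPdeg : P.natDegree = n)
    (hPint : ∀ k, ∫ x in (a k)..(b k), P.eval x / √(-(T.eval x)) = 0)
    (hQmonic : Q.Monic) (hQdeg : Q.natDegree = n + 1)
    (hQint : ∀ k, ∫ x in (a k)..(b k), Q.eval x / √(-(T.eval x)) = 0) (y : ℝ) :
    (wronskian P Q).eval y ≠ 0 := by
  intro hW
  simp only [wronskian, eval_sub, eval_mul] at hW
  obtain ⟨α, β, h0, h1, h2⟩ : ∃ α β : ℝ, (α ≠ 0 ∨ β ≠ 0) ∧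
      α * P.eval y + β * Q.eval y = 0 ∧
      α * (derivative P).eval y + β * (derivative Q).eval y = 0 := by
    by_cases h : P.eval y = 0 ∧ Q.eval y = 0
    · by_cases h' : (derivative P).eval y = 0
      · exact ⟨1, 0, by simp, by simp [h], by simp [h']⟩
      · exact ⟨-(derivative Q).eval y, (derivative P).eval y, Or.inr h', by simp [h], by ring⟩
    · refine ⟨Q.eval y, -P.eval y, ?_, by ring, by linarith⟩
      by_contra! h'
      exact h ⟨neg_eq_zero.1 h'.2, h'.1⟩
  set G := C α * P + C β * Q with hG
  have hPn : P.coeff n = 1 := hPdeg ▸ hPmonic.coeff_natDegree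
  have hPn1 : P.coeff (n + 1) = 0 := coeff_eq_zero_of_natDegree_lt (by omega)
  have hQn1 : Q.coeff (n + 1) = 1 := hQdeg ▸ hQmonic.coeff_natDegree
  have hG0 : G ≠ 0 := by
    intro hz
    have hβ : β = 0 := by simpa [hG, hPn1, hQn1] using congrArg (fun p => p.coeff (n + 1)) hz
    have hα : α = 0 := by simpa [hG, hβ, hPn] using congrArg (fun p => p.coeff n) hz
    simp [hα, hβ] at h0
  have hGdeg : G.natDegree ≤ n + 1 := by
    refine natDegree_add_le_of_degree_le ?_ ?_
    · exact (natDegree_C_mul_le _ _).trans (by omega)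
    · exact (natDegree_C_mul_le _ _).trans hQdeg.le
  have hmult : 1 < G.rootMultiplicity y := by
    rw [one_lt_rootMultiplicity_iff_isRoot hG0]
    exact ⟨by simpa [IsRoot, hG] using h1, by simpa [IsRoot, hG] using h2⟩
  obtain ⟨V, hV⟩ := (le_rootMultiplicity_iff hG0).1 (Nat.succ_le_of_lt hmult)
  have hV0 : V ≠ 0 := by
    rintro rfl
    exact hG0 (by simpa using hV)
  refine hV0 (eq_zero_of_root_in_gaps hsep ?_ fun k => ?_)
  · have := natDegree_mul (pow_ne_zero 2 (X_sub_C_ne_zero y)) hV0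
    rw [← natDegree_lt_iff_degree_lt hV0]
    simp only [Nat.succ_eq_add_one, Nat.reduceAdd] at hV
    rw [← hV, natDegree_pow, natDegree_X_sub_C] at this
    omega
  · refine exists_root_of_integral_eq_zero (H := (X - C y) ^ 2) (hab k) (hT k) (hi k)
      (fun x => by simpa using sq_nonneg (x - y)) ?_ ?_
    · exact hV ▸ hG0
    · have := integral_combination_eq_zero (hi k) (hPint k) (hQint k) α β
      rw [← hG, hV] at this
      exact this

/-- Lagrange's identity: the residues of `F / ∏ (x - v i)` sum to zero when `F` has low degree. -/
lemma sum_eval_div_derivative_nodal_eq_zero {ι : Type*} [Fintype ι] {v : ι → ℝ}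
    (hv : Function.Injective v) {F : ℝ[X]} {n : ℕ} (hn : Fintype.card ι = n + 1)
    (hF : F.degree < n) :
    ∑ i, F.eval (v i) / (derivative (Lagrange.nodal Finset.univ v)).eval (v i) = 0 := by
  classical
  have hlt : F.degree < (Finset.univ : Finset ι).card := by
    rw [Finset.card_univ, hn]
    exact hF.trans (by exact_mod_cast n.lt_succ_self)
  have h := Lagrange.coeff_eq_sum hv.injOn hlt
  rw [Finset.card_univ, hn, Nat.add_sub_cancel, coeff_eq_zero_of_degree_lt hF] at h
  rw [h]
  refine Finset.sum_congr rfl fun i hi => ?_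
  rw [Lagrange.eval_nodal_derivative_eval_node_eq hi, Lagrange.eval_nodal]

/-- The polynomials `A`, `B` of degree less than `n` with `A P + B Q` proportional to
`∏ (x - a_j) (x - b_j)` are trivial. -/
lemma eq_zero_of_combination_eq {n : ℕ} (hn : 1 ≤ n) {a b : Fin n → ℝ} (hab : ∀ j, a j < b j)
    (hsep : ∀ j k : Fin n, j < k → b k < a j) {T P Q : ℝ[X]}
    (hT : ∀ k, ∀ x ∈ Set.Ioo (a k) (b k), T.eval x < 0)
    (hi : ∀ k, ∀ p : ℝ[X],
      IntervalIntegrable (fun x => p.eval x / √(-(T.eval x))) volume (a k) (b k))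
    (hPmonic : P.Monic) (hPdeg : P.natDegree = n)
    (hPint : ∀ k, ∫ x in (a k)..(b k), P.eval x / √(-(T.eval x)) = 0)
    (hQmonic : Q.Monic) (hQdeg : Q.natDegree = n + 1)
    (hQint : ∀ k, ∫ x in (a k)..(b k), Q.eval x / √(-(T.eval x)) = 0)
    {R : ℝ[X]} (hRa : ∀ k, R.eval (a k) = 0)
    (hR : ∀ k, ∀ x ∈ Set.Ioo (a k) (b k), R.eval x < 0)
    {A B : ℝ[X]} (hA : A.degree < n) (hB : B.degree < n) {γ : ℝ}
    (hABR : A * P + B * Q = C γ * R) : A = 0 ∧ B = 0 := by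
  have hzero : ∀ G : ℝ[X], G ≠ 0 →
      (∀ k, ∫ x in (a k)..(b k), G.eval x / √(-(T.eval x)) = 0) →
      ∀ k, ∃ x ∈ Set.Ioo (a k) (b k), G.eval x = 0 := fun G hG hint k =>
    exists_root_of_integral_eq_zero (H := 1) (hab k) (hT k) (hi k) (by simp) (by simpa using hG)
      (by simpa using hint k)
  let i₀ : Fin n := ⟨0, hn⟩
  have hinj : ∀ c : Fin n → ℝ, (∀ k, c k ∈ Set.Ioo (a k) (b k)) →
      Function.Injective (fun o : Option (Fin n) => o.elim (a i₀) c) := by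
    intro c hc
    have hne : ∀ k, c k ≠ a i₀ := by
      intro k
      rcases eq_or_ne k i₀ with rfl | hk
      · exact (hc _).1.ne'
      · have : i₀ < k := Nat.pos_of_ne_zero fun h => hk (Fin.ext h)
        exact ((hc k).2.trans (hsep _ _ this)).ne
    rintro (_ | i) (_ | j) h
    · rfl
    · exact absurd h.symm (hne j)
    · exact absurd h (hne i)
    · exact congrArg some (injective_of_mem_gaps hsep hc h)
  have hcard : Fintype.card (Option (Fin n)) = n + 1 := by simp
  have hPa : P.eval (a i₀) ≠ 0 := by
    intro h0
    choose c hc hc0 using hzero P hPmonic.ne_zero hPint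
    refine hPmonic.ne_zero (eq_zero_of_natDegree_lt_card_of_eval_eq_zero P (hinj c hc) ?_
      (by omega))
    rintro (_ | i)
    · exact h0
    · exact hc0 i
  set σ := Q.eval (a i₀) / P.eval (a i₀) with hσ
  set W := C (-σ) * P + C 1 * Q with hW
  have hWQ : W = Q + C (-σ) * P := by rw [hW, C_1]; ring
  have hdegP : (C (-σ) * P).degree < Q.degree :=
    degree_lt_degree (lt_of_le_of_lt (natDegree_C_mul_le _ _) (by omega))
  have hWmonic : W.Monic := hWQ ▸ hQmonic.add_of_left hdegP
  have hWdeg : W.natDegree = n + 1 := by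
    rw [hWQ, natDegree_add_eq_left_of_degree_lt hdegP, hQdeg]
  choose c hc hc0 using hzero W hWmonic.ne_zero fun k =>
    integral_combination_eq_zero (hi k) (hPint k) (hQint k) (-σ) 1
  set w : Option (Fin n) → ℝ := fun o => o.elim (a i₀) c with hw
  have hwinj : Function.Injective w := hinj c hc
  have hw0 : ∀ o, W.eval (w o) = 0 := by
    rintro (_ | i)
    · simp only [hw, hW, hσ, Option.elim, eval_add, eval_mul, eval_C]
      field_simp
      ring
    · exact hc0 i
  have hWnodal : W = Lagrange.nodal Finset.univ w := by
    rw [← sub_eq_zero]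
    refine eq_zero_of_degree_lt_of_eval_index_eq_zero (s := Finset.univ) (v := w) hwinj.injOn ?_ ?_
    · have hd : W.degree = (Lagrange.nodal Finset.univ w).degree := by
        rw [Lagrange.degree_nodal, Finset.card_univ, hcard, degree_eq_natDegree hWmonic.ne_zero,
          hWdeg]
      refine (degree_sub_lt_left hd hWmonic.ne_zero ?_).trans_eq ?_
      · rw [hWmonic.leadingCoeff, Lagrange.nodal_monic.leadingCoeff]
      · rw [hd, Lagrange.degree_nodal]
    · intro o ho
      rw [eval_sub, hw0, Lagrange.eval_nodal_at_node ho, sub_zero]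
  have hwr : ∀ o, P.eval (w o) * (derivative W).eval (w o) = (wronskian P Q).eval (w o) := by
    intro o
    have h := hw0 o
    simp only [hW, wronskian, derivative_add, derivative_mul, derivative_C, eval_add, eval_sub,
      eval_mul, eval_C, zero_mul, zero_add] at h ⊢
    linear_combination (derivative P).eval (w o) * h
  have hwr0 := wronskian_eval_ne_zero hab hsep hT hi hPmonic hPdeg hPint hQmonic hQdeg hQint
  have hPw : ∀ o, P.eval (w o) ≠ 0 := fun o h => hwr0 (w o) (by rw [← hwr, h, zero_mul])
  set F := A + C σ * B with hF
  have hFdeg : F.degree < n :=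
    (degree_add_le _ _).trans_lt (max_lt hA ((C_mul' σ B ▸ degree_smul_le σ B).trans_lt hB))
  have hFP : F * P + B * W = C γ * R := by
    rw [← hABR, hF, hW, C_1, C_neg]
    ring
  have hFw : ∀ o, F.eval (w o) * P.eval (w o) = γ * R.eval (w o) := by
    intro o
    simpa [hw0 o] using congrArg (eval (w o)) hFP
  have hsum : γ * ∑ i, R.eval (c i) / (wronskian P Q).eval (c i) = 0 := by
    have h := sum_eval_div_derivative_nodal_eq_zero hwinj hcard hFdeg
    rw [← hWnodal] at h
    have hterm : ∀ o, F.eval (w o) / (derivative W).eval (w o)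
        = γ * (R.eval (w o) / (wronskian P Q).eval (w o)) := by
      intro o
      rw [← hwr, ← mul_div_assoc, ← hFw, mul_comm (F.eval _), mul_div_mul_left _ _ (hPw o)]
    rw [Finset.sum_congr rfl fun o _ => hterm o, ← Finset.mul_sum, Fintype.sum_option] at h
    simpa [hw, hRa] using h
  have hγ : γ = 0 := by
    refine (mul_eq_zero.1 hsum).resolve_right ?_
    have hne : (Finset.univ : Finset (Fin n)).Nonempty := ⟨i₀, Finset.mem_univ _⟩
    rcases eval_pos_or_neg_of_ne_zero isPreconnected_univ fun x _ => hwr0 x with h | h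
    · exact (Finset.sum_neg (fun i _ => div_neg_of_neg_of_pos (hR i _ (hc i))
        (h _ (Set.mem_univ _))) hne).ne
    · exact (Finset.sum_pos (fun i _ => div_pos_of_neg_of_neg (hR i _ (hc i))
        (h _ (Set.mem_univ _))) hne).ne'
  have hF0 : F = 0 := by
    refine eq_zero_of_degree_lt_of_eval_index_eq_zero (s := Finset.univ) (v := c)
      (injective_of_mem_gaps hsep hc).injOn (by simpa using hFdeg) fun i _ => ?_
    have h := hFw (some i)
    rw [hγ, zero_mul] at h
    exact (mul_eq_zero.1 h).resolve_right (hPw (some i))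
  have hB0 : B = 0 := by
    rw [hF0, hγ, C_0, zero_mul, zero_mul, zero_add] at hFP
    exact (mul_eq_zero.1 hFP).resolve_right hWmonic.ne_zero
  refine ⟨?_, hB0⟩
  simpa [hF, hB0] using hF0

lemma gap_endpoint_bounds {n : ℕ} {a b : Fin n → ℝ} (hab : ∀ j, a j < b j)
    (hsep : ∀ j k : Fin n, j < k → b k < a j) {j k : Fin n} (hjk : j ≠ k) {x : ℝ}
    (hx : x ∈ Set.Icc (a k) (b k)) : 0 < (x - a j) * (x - b j) := by
  rcases lt_or_gt_of_ne hjk with h | h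
  · have := hsep _ _ h
    exact mul_pos_of_neg_of_neg (by linarith [hx.2]) (by linarith [hx.2, hab j])
  · have := hsep _ _ h
    exact mul_pos (by linarith [hx.1, hab j]) (by linarith [hx.1])

lemma sumElim_injective {n : ℕ} {a b : Fin n → ℝ} (hab : ∀ j, a j < b j)
    (hsep : ∀ j k : Fin n, j < k → b k < a j) : Function.Injective (Sum.elim a b) := by
  have h : ∀ {j k : Fin n} {x : ℝ}, x ∈ Set.Icc (a j) (b j) → x ∈ Set.Icc (a k) (b k) →
      j = k := by
    intro j k x hj hk
    by_contra hne
    rcases lt_or_gt_of_ne hne with h | h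
    · linarith [hsep _ _ h, hj.1, hk.2]
    · linarith [hsep _ _ h, hk.1, hj.2]
  have ha : ∀ j, a j ∈ Set.Icc (a j) (b j) := fun j => Set.left_mem_Icc.2 (hab j).le
  have hb : ∀ j, b j ∈ Set.Icc (a j) (b j) := fun j => Set.right_mem_Icc.2 (hab j).le
  rintro (i | i) (j | j) hij <;> simp only [Sum.elim_inl, Sum.elim_inr] at hij
  · exact congrArg Sum.inl (h (ha i) (hij ▸ ha j))
  · obtain rfl := h (ha i) (k := j) (by rw [hij]; exact hb j)
    exact absurd hij (hab i).ne
  · obtain rfl := h (hb i) (k := j) (by rw [hij]; exact ha j)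
    exact absurd hij (hab i).ne'
  · exact congrArg Sum.inr (h (hb i) (hij ▸ hb j))

/-- A polynomial vanishing at as many distinct points as its degree allows is a multiple of the
nodal polynomial. -/
lemma exists_eq_C_mul_nodal {ι : Type*} [Fintype ι] {v : ι → ℝ} (hv : Function.Injective v)
    {N : ℝ[X]} (hdeg : N.natDegree ≤ Fintype.card ι) (hN : ∀ i, N.eval (v i) = 0) :
    ∃ γ : ℝ, N = C γ * Lagrange.nodal Finset.univ v := by
  refine ⟨N.coeff (Fintype.card ι), ?_⟩
  rw [← sub_eq_zero]
  have hnd : (Lagrange.nodal Finset.univ v).natDegree = Fintype.card ι := by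
    rw [Lagrange.natDegree_nodal, Finset.card_univ]
  have hc : (Lagrange.nodal Finset.univ v).coeff (Fintype.card ι) = 1 :=
    hnd ▸ Lagrange.nodal_monic.coeff_natDegree
  refine eq_zero_of_degree_lt_of_eval_index_eq_zero (s := Finset.univ) (v := v) hv.injOn ?_ ?_
  · rw [Finset.card_univ, degree_lt_iff_coeff_zero]
    intro m hm
    rw [coeff_sub, coeff_C_mul]
    rcases hm.eq_or_lt with rfl | hlt
    · rw [hc, mul_one, sub_self]
    · rw [coeff_eq_zero_of_natDegree_lt (hdeg.trans_lt hlt),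
        coeff_eq_zero_of_natDegree_lt (hnd.trans_lt hlt), mul_zero, sub_zero]
  · intro i hi
    rw [eval_sub, eval_mul, Lagrange.eval_nodal_at_node hi, hN, mul_zero, sub_zero]

/-- The normalized differentials of the first kind are linearly independent. -/
lemma eq_zero_of_sum_C_mul_eq_zero {n : ℕ} {a b : Fin n → ℝ} {T : ℝ[X]}
    (hi : ∀ k, ∀ p : ℝ[X],
      IntervalIntegrable (fun x => p.eval x / √(-(T.eval x))) volume (a k) (b k))
    {O : Fin n → ℝ[X]}
    (hOint : ∀ k j, ∫ x in (a j)..(b j), (O k).eval x / √(-(T.eval x))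
        = Real.pi * (if k = j then 1 else 0))
    {u : Fin n → ℝ} (hu : ∑ k, C (u k) * O k = 0) (j : Fin n) : u j = 0 := by
  have h : ∫ x in (a j)..(b j), ∑ k, u k * ((O k).eval x / √(-(T.eval x))) = 0 := by
    have : ∀ x, ∑ k, u k * ((O k).eval x / √(-(T.eval x))) = 0 := by
      intro x
      have hx := congrArg (eval x) hu
      simp only [eval_finsetSum, eval_mul, eval_C, eval_zero] at hx
      simp only [← mul_div_assoc, ← Finset.sum_div, hx, zero_div]
    simp [this]
  rw [intervalIntegral.integral_finsetSum fun k _ => (hi j (O k)).const_mul (u k)] at h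
  simpa [hOint, Real.pi_ne_zero] using h

lemma degree_sum_C_mul_lt {n : ℕ} (hn : 1 ≤ n) {O : Fin n → ℝ[X]}
    (hO : ∀ k, (O k).degree ≤ (n - 1 : ℕ)) (u : Fin n → ℝ) :
    (∑ k, C (u k) * O k).degree < n := by
  refine (degree_sum_le _ _).trans_lt ((Finset.sup_lt_iff (WithBot.bot_lt_coe n)).2 fun k _ => ?_)
  rw [C_mul']
  refine (degree_smul_le _ _).trans_lt ((hO k).trans_lt ?_)
  exact WithBot.coe_lt_coe.2 (Nat.sub_lt hn one_pos)

end FiniteGap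

open FiniteGap

/-- Theorem 4.4, unique solvability: For the finite-gap data
`0 < a_n < b_n < ⋯ < a_1 < b_1`, `T(x) = x ∏ (x-a_j)(x-b_j)`, the normalized
polynomials `P`, `Q = x·P¹`, the abelian differentials of the first kind `O^{(k)}`
(normalized by `∫_{a_j}^{b_j} O^{(k)}/√(-T) = π δ_{kj}`), and `Q^{(t)} = Q - κP`,
the `2n × 2n` matrix `𝒳` of the variational system is invertible. -/
theorem stmt_4 (n : ℕ) (hn : 1 ≤ n) (a b : Fin n → ℝ)
    (ha0 : ∀ j, 0 < a j) (hab : ∀ j, a j < b j)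
    (hsep : ∀ j k : Fin n, j < k → b k < a j)
    (T : Polynomial ℝ) (hT : T = X * ∏ j, (X - C (a j)) * (X - C (b j)))
    (P : Polynomial ℝ) (hPmonic : P.Monic) (hPdeg : P.natDegree = n)
    (hPint : ∀ k, ∫ x in (a k)..(b k), P.eval x / Real.sqrt (-(T.eval x)) = 0)
    (P1 : Polynomial ℝ) (hP1monic : P1.Monic) (hP1deg : P1.natDegree = n)
    (Q : Polynomial ℝ) (hQ : Q = X * P1)
    (hQint : ∀ k, ∫ x in (a k)..(b k), Q.eval x / Real.sqrt (-(T.eval x)) = 0)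
    (O : Fin n → Polynomial ℝ) (hOdeg : ∀ k, (O k).degree ≤ (n - 1 : ℕ))
    (hOint : ∀ k j, ∫ x in (a j)..(b j), (O k).eval x / Real.sqrt (-(T.eval x))
        = Real.pi * (if k = j then 1 else 0))
    (κ : ℝ) (Qt : Polynomial ℝ) (hQt : Qt = Q - C κ * P) :
    IsUnit (Matrix.of (fun r c : Fin n ⊕ Fin n =>
      match r, c with
      | Sum.inl k, Sum.inl j =>
          (O k).eval (a j) * P.eval (a j) / (derivative T).eval (a j)
      | Sum.inl k, Sum.inr j =>
          (O k).eval (b j) * P.eval (b j) / (derivative T).eval (b j)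
      | Sum.inr k, Sum.inl j =>
          3 * ((O k).eval (a j) * Qt.eval (a j)) / (derivative T).eval (a j)
      | Sum.inr k, Sum.inr j =>
          3 * ((O k).eval (b j) * Qt.eval (b j)) / (derivative T).eval (b j))) := by
  set R : ℝ[X] := Lagrange.nodal Finset.univ (Sum.elim a b) with hR
  have hRprod : R = ∏ j, (X - C (a j)) * (X - C (b j)) := by
    rw [hR, Lagrange.nodal_eq, Fintype.prod_sum_type, Finset.prod_mul_distrib]
    rfl
  set S : Fin n → ℝ[X] := fun k => ∏ j ∈ Finset.univ.erase k, (X - C (a j)) * (X - C (b j))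
    with hS
  have hRS : ∀ k, R = (X - C (a k)) * (X - C (b k)) * S k := fun k => by
    rw [hRprod]
    exact (Finset.mul_prod_erase Finset.univ (fun j => (X - C (a j)) * (X - C (b j)))
      (Finset.mem_univ k)).symm
  have hTS : ∀ k, T = (X - C (a k)) * (X - C (b k)) * (X * S k) := fun k => by
    rw [hT, ← hRprod, hRS k]
    ring
  have hSpos : ∀ k, ∀ x ∈ Set.Icc (a k) (b k), 0 < (S k).eval x := by
    intro k x hx
    rw [hS, eval_prod]
    refine Finset.prod_pos fun j hj => ?_
    simpa using gap_endpoint_bounds hab hsep (Finset.ne_of_mem_erase hj) hx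
  have hXSpos : ∀ k, ∀ x ∈ Set.Icc (a k) (b k), 0 < (X * S k).eval x := by
    intro k x hx
    rw [eval_mul, eval_X]
    exact mul_pos ((ha0 k).trans_le hx.1) (hSpos k x hx)
  have hRneg : ∀ k, ∀ x ∈ Set.Ioo (a k) (b k), R.eval x < 0 := by
    intro k x hx
    rw [hRS k]
    simp only [eval_mul, eval_sub, eval_X, eval_C]
    exact mul_neg_of_neg_of_pos (mul_neg_of_pos_of_neg (sub_pos.2 hx.1) (sub_neg.2 hx.2))
      (hSpos k x ⟨hx.1.le, hx.2.le⟩)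
  have hTneg : ∀ k, ∀ x ∈ Set.Ioo (a k) (b k), T.eval x < 0 := by
    intro k x hx
    rw [hT, ← hRprod, eval_mul, eval_X]
    exact mul_neg_of_pos_of_neg ((ha0 k).trans hx.1) (hRneg k x hx)
  have hi : ∀ k, ∀ p : ℝ[X],
      IntervalIntegrable (fun x => p.eval x / √(-(T.eval x))) volume (a k) (b k) :=
    fun k p => intervalIntegrable_div_sqrt (hab k) (hTS k) (hXSpos k) p
  have hTa : ∀ k, (derivative T).eval (a k) ≠ 0 := by
    intro k
    have : (derivative T).eval (a k) = (a k - b k) * (X * S k).eval (a k) := by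
      rw [hTS k, derivative_mul, derivative_mul]
      simp
    rw [this]
    exact mul_ne_zero (sub_neg.2 (hab k)).ne (hXSpos k _ (Set.left_mem_Icc.2 (hab k).le)).ne'
  have hTb : ∀ k, (derivative T).eval (b k) ≠ 0 := by
    intro k
    have : (derivative T).eval (b k) = (b k - a k) * (X * S k).eval (b k) := by
      rw [hTS k, derivative_mul, derivative_mul]
      simp
    rw [this]
    exact mul_ne_zero (sub_pos.2 (hab k)).ne' (hXSpos k _ (Set.right_mem_Icc.2 (hab k).le)).ne'
  have hQmonic : Q.Monic := hQ ▸ monic_X.mul hP1monic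
  have hQdeg : Q.natDegree = n + 1 := by
    rw [hQ, natDegree_X_mul hP1monic.ne_zero, hP1deg]
  rw [Matrix.isUnit_iff_isUnit_det, isUnit_iff_ne_zero]
  intro hdet
  obtain ⟨v, hv0, hv⟩ := Matrix.exists_vecMul_eq_zero_iff.2 hdet
  refine hv0 ?_
  set A₀ := ∑ k, C (v (Sum.inl k)) * O k with hA₀
  set B₀ := ∑ k, C (v (Sum.inr k)) * O k with hB₀
  have hA₀deg := degree_sum_C_mul_lt hn hOdeg fun k => v (Sum.inl k)
  have hB₀deg := degree_sum_C_mul_lt hn hOdeg fun k => v (Sum.inr k)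
  have hCdeg : ∀ r : ℝ, (C r * B₀).degree < n := fun r =>
    (C_mul' r B₀ ▸ degree_smul_le r B₀).trans_lt hB₀deg
  set A := A₀ - C (3 * κ) * B₀ with hA
  set B := C 3 * B₀ with hB
  have hAdeg : A.degree < n := (degree_sub_le _ _).trans_lt (max_lt hA₀deg (hCdeg _))
  have hBdeg : B.degree < n := hCdeg 3
  have hNeval : ∀ x, (A * P + B * Q).eval x = (∑ k, v (Sum.inl k) * ((O k).eval x * P.eval x))
      + ∑ k, v (Sum.inr k) * (3 * ((O k).eval x * Qt.eval x)) := by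
    intro x
    have h1 : ∑ k, v (Sum.inl k) * ((O k).eval x * P.eval x) = A₀.eval x * P.eval x := by
      simp only [hA₀, eval_finsetSum, eval_mul, eval_C, Finset.sum_mul, mul_assoc]
    have h2 : ∑ k, v (Sum.inr k) * (3 * ((O k).eval x * Qt.eval x))
        = 3 * (B₀.eval x * Qt.eval x) := by
      simp only [hB₀, eval_finsetSum, eval_mul, eval_C, Finset.sum_mul, Finset.mul_sum]
      exact Finset.sum_congr rfl fun k _ => by ring
    rw [h1, h2, hA, hB, hQt]
    simp only [eval_add, eval_sub, eval_mul, eval_C]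
    ring
  have hNroot : ∀ e, (A * P + B * Q).eval (Sum.elim a b e) = 0 := by
    rintro (j | j)
    · have h := congrFun hv (Sum.inl j)
      simp only [Matrix.vecMul, dotProduct, Fintype.sum_sum_type, Matrix.of_apply, Pi.zero_apply,
        ← mul_div_assoc, ← Finset.sum_div, ← add_div] at h
      rw [Sum.elim_inl, hNeval]
      exact (div_eq_zero_iff.1 h).resolve_right (hTa j)
    · have h := congrFun hv (Sum.inr j)
      simp only [Matrix.vecMul, dotProduct, Fintype.sum_sum_type, Matrix.of_apply, Pi.zero_apply,
        ← mul_div_assoc, ← Finset.sum_div, ← add_div] at h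
      rw [Sum.elim_inr, hNeval]
      exact (div_eq_zero_iff.1 h).resolve_right (hTb j)
  have hnat : ∀ {p : ℝ[X]}, p.degree < n → p.natDegree ≤ n - 1 := fun {p} hp => by
    rcases eq_or_ne p 0 with rfl | hp0
    · simp
    · exact Nat.le_sub_one_of_lt ((natDegree_lt_iff_degree_lt hp0).2 hp)
  have hNdeg : (A * P + B * Q).natDegree ≤ Fintype.card (Fin n ⊕ Fin n) := by
    have h1 := hnat hAdeg
    have h2 := hnat hBdeg
    rw [Fintype.card_sum, Fintype.card_fin]
    refine natDegree_add_le_of_degree_le ?_ ?_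
    · exact natDegree_mul_le.trans (by omega)
    · exact natDegree_mul_le.trans (by omega)
  obtain ⟨γ, hγ⟩ := exists_eq_C_mul_nodal (sumElim_injective hab hsep) hNdeg hNroot
  obtain ⟨hA0, hB0⟩ := eq_zero_of_combination_eq hn hab hsep hTneg hi hPmonic hPdeg hPint hQmonic
    hQdeg hQint (fun k => by simp [hRS k]) hRneg hAdeg hBdeg hγ
  have hB₀0 : B₀ = 0 := (mul_eq_zero.1 hB0).resolve_left (by simp)
  have hA₀0 : A₀ = 0 := by simpa [hA, hB₀0] using hA0
  funext r
  rcases r with k | k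
  · exact eq_zero_of_sum_C_mul_eq_zero hi hOint (u := fun k => v (Sum.inl k)) hA₀0 k
  · exact eq_zero_of_sum_C_mul_eq_zero hi hOint (u := fun k => v (Sum.inr k)) hB₀0 k
end

section
/- Suppose in addition that P(x) = ∏_{j=1}^n (x - c_j) with c_j ∈ (a_j, b_j) for each j, and that Q(c_j) ≠ 0 for all j. Set T₁(x) = ∏_{j=1}^n (x - a_j)(x - b_j). Then 1 < ∑_{j=1}^n T₁(c_j)/(P'(c_j)·Q(c_j)). -/
open Polynomial MeasureTheory intervalIntegral

lemma intervalIntegrable_one_div_sqrt_mul {a b : ℝ} (hab : a < b) :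
    IntervalIntegrable (fun x => 1 / Real.sqrt ((x - a) * (b - x))) volume a b := by
  have hderiv : IntervalIntegrable
      (fun x => 1 / (2 * Real.sqrt (x - a)) + 1 / (2 * Real.sqrt (b - x))) volume a b := by
    apply intervalIntegrable_deriv_of_nonneg
      (g := fun x => Real.sqrt (x - a) - Real.sqrt (b - x))
    · fun_prop
    · intro x hx
      rw [min_eq_left hab.le, max_eq_right hab.le] at hx
      have h1 := ((hasDerivAt_id x).sub_const a).sqrt (sub_pos.2 hx.1).ne'
      have h2 := ((hasDerivAt_id x).const_sub b).sqrt (sub_pos.2 hx.2).ne'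
      refine (h1.sub h2).congr_deriv ?_
      rw [neg_div, sub_neg_eq_add]
      rfl
    · intro x _
      positivity
  refine (hderiv.const_mul (2 / Real.sqrt (b - a))).mono_fun'
    (by measurability) ?_
  rw [Set.uIoc_of_le hab.le]
  refine (ae_restrict_iff' measurableSet_Ioc).2 (Filter.Eventually.of_forall fun x hx => ?_)
  have hu : 0 ≤ x - a := by linarith [hx.1]
  have hv : 0 ≤ b - x := by linarith [hx.2]
  beta_reduce
  rw [Real.norm_of_nonneg (by positivity), Real.sqrt_mul hu]
  rcases hv.eq_or_lt with hv0 | hv0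
  · rw [← hv0]
    simp only [Real.sqrt_zero, mul_zero, div_zero]
    positivity
  have hp : 0 < Real.sqrt (x - a) := Real.sqrt_pos.2 (by linarith [hx.1])
  have hq : 0 < Real.sqrt (b - x) := Real.sqrt_pos.2 hv0
  have hl : 0 < Real.sqrt (b - a) := Real.sqrt_pos.2 (by linarith)
  have hle : Real.sqrt (b - a) ≤ Real.sqrt (x - a) + Real.sqrt (b - x) := by
    rw [Real.sqrt_le_left (by positivity)]
    nlinarith [Real.sq_sqrt hu, Real.sq_sqrt hv]
  have heq : 2 / Real.sqrt (b - a) *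
      (1 / (2 * Real.sqrt (x - a)) + 1 / (2 * Real.sqrt (b - x))) =
      (Real.sqrt (x - a) + Real.sqrt (b - x)) / Real.sqrt (b - a) *
        (1 / (Real.sqrt (x - a) * Real.sqrt (b - x))) := by
    field_simp
    ring
  rw [heq]
  exact le_mul_of_one_le_left (by positivity) ((one_le_div hl).2 hle)

/-- Integration of polynomials against `1 / √(-T)` over a gap `(a, b)` bounded by simple roots
of `T` is a strictly positive linear functional. -/
lemma exists_gap_functional {a b : ℝ} (hab : a < b) {T K : ℝ[X]}
    (hT : T = (X - C a) * (X - C b) * K) (hK : ∀ x ∈ Set.Icc a b, 0 < K.eval x) :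
    ∃ L : ℝ[X] →ₗ[ℝ] ℝ,
      (∀ D, L D = ∫ x in a..b, D.eval x / Real.sqrt (-(T.eval x))) ∧
      ∀ D : ℝ[X], D ≠ 0 → (∀ x ∈ Set.Ioo a b, 0 ≤ D.eval x) → 0 < L D := by
  have hTe : ∀ x, -(T.eval x) = ((x - a) * (b - x)) * K.eval x := by
    intro x
    simp only [hT, eval_mul, eval_sub, eval_X, eval_C]
    ring
  have hint : ∀ D : ℝ[X], IntervalIntegrable
      (fun x => D.eval x / Real.sqrt (-(T.eval x))) volume a b := by
    intro D
    have hcont : ContinuousOn (fun x => D.eval x / Real.sqrt (K.eval x)) (Set.uIcc a b) := by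
      rw [Set.uIcc_of_le hab.le]
      refine ContinuousOn.div (by fun_prop) (by fun_prop) fun x hx => ?_
      exact (Real.sqrt_pos.2 (hK x hx)).ne'
    refine ((intervalIntegrable_one_div_sqrt_mul hab).mul_continuousOn hcont).congr ?_
    rw [Set.uIoc_of_le hab.le]
    intro x hx
    have hu : 0 ≤ (x - a) * (b - x) := mul_nonneg (by linarith [hx.1]) (by linarith [hx.2])
    simp only [hTe, Real.sqrt_mul hu]
    rw [div_mul_div_comm, one_mul]
  refine ⟨{ toFun := fun D => ∫ x in a..b, D.eval x / Real.sqrt (-(T.eval x))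
            map_add' := fun D E => ?_
            map_smul' := fun r D => ?_ }, fun D => rfl, fun D hD hnn => ?_⟩
  · rw [← integral_add (hint D) (hint E)]
    simp only [eval_add, add_div]
  · simp only [eval_smul, smul_eq_mul, RingHom.id_apply]
    rw [← intervalIntegral.integral_const_mul]
    simp only [mul_div_assoc]
  · change 0 < ∫ x in a..b, D.eval x / Real.sqrt (-(T.eval x))
    rw [integral_pos_iff_support_of_nonneg_ae' _ (hint D)]
    · refine ⟨hab, ?_⟩
      have hsub : Set.Ioo a b \ (D.roots.toFinset : Set ℝ) ⊆
          (Function.support fun x => D.eval x / Real.sqrt (-(T.eval x))) ∩ Set.Ioc a b := by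
        rintro x ⟨hx, hxr⟩
        refine ⟨?_, Set.Ioo_subset_Ioc_self hx⟩
        refine (div_ne_zero ?_ ?_)
        · intro h0
          exact hxr (by simp [hD, h0])
        · rw [hTe]
          exact (Real.sqrt_pos.2 (mul_pos (mul_pos (by linarith [hx.1]) (by linarith [hx.2]))
            (hK x (Set.Ioo_subset_Icc_self hx)))).ne'
      refine lt_of_lt_of_le ?_ (measure_mono hsub)
      rw [measure_sdiff_null ((Finset.finite_toSet _).measure_zero _), Real.volume_Ioo]
      simpa using hab
    · rw [Set.uIoc_of_le hab.le, ← restrict_Ioo_eq_restrict_Ioc]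
      refine (ae_restrict_iff' measurableSet_Ioo).2 (Filter.Eventually.of_forall fun x hx => ?_)
      exact div_nonneg (hnn x hx) (Real.sqrt_nonneg _)

/-- Inverse positivity of a matrix with nonpositive off-diagonal entries that maps some positive
vector to a positive vector. -/
lemma pos_of_offDiag_nonpos {ι : Type*} [Fintype ι] (M : ι → ι → ℝ)
    (hM : ∀ k j, j ≠ k → M k j ≤ 0) (y : ι → ℝ) (hy : ∀ j, 0 < y j)
    (hMy : ∀ k, 0 < ∑ j, M k j * y j) (v : ι → ℝ) (hMv : ∀ k, 0 < ∑ j, M k j * v j) (i : ι) :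
    0 < v i := by
  obtain ⟨k, -, hk⟩ := Finset.exists_min_image Finset.univ (fun j => v j / y j)
    ⟨i, Finset.mem_univ i⟩
  suffices h : 0 < v k / y k by
    exact (div_pos_iff_of_pos_right (hy i)).1 (h.trans_le (hk i (Finset.mem_univ i)))
  by_contra! hneg
  have h1 : ∑ j, M k j * (v j - v k / y k * y j) ≤ 0 := by
    refine Finset.sum_nonpos fun j _ => ?_
    by_cases hj : j = k
    · subst hj
      rw [div_mul_cancel₀ _ (hy j).ne', sub_self, mul_zero]
    · refine mul_nonpos_of_nonpos_of_nonneg (hM k j hj) (sub_nonneg.2 ?_)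
      exact (le_div_iff₀ (hy j)).1 (hk j (Finset.mem_univ j))
  have h2 : ∑ j, M k j * (v j - v k / y k * y j) =
      ∑ j, M k j * v j - v k / y k * ∑ j, M k j * y j := by
    rw [Finset.mul_sum, ← Finset.sum_sub_distrib]
    exact Finset.sum_congr rfl fun j _ => by ring
  nlinarith [hMv k, hMy k]

lemma eq_C_mul_prod_add_sum {n : ℕ} {c : Fin n → ℝ} (hc : Function.Injective c) {D : ℝ[X]}
    (hD : D.natDegree ≤ n) :
    D = C (D.coeff n) * ∏ j, (X - C (c j)) +
      ∑ j, C (D.eval (c j) / ∏ i ∈ Finset.univ.erase j, (c j - c i)) *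
        ∏ i ∈ Finset.univ.erase j, (X - C (c i)) := by
  set P : ℝ[X] := ∏ j, (X - C (c j)) with hP
  have hPm : P.Monic := monic_prod_of_monic _ _ fun j _ => monic_X_sub_C _
  have hPd : P.natDegree = n := by simp [hP, natDegree_prod_of_monic, monic_X_sub_C]
  have hPc : P.coeff n = 1 := by rw [← hPd]; exact hPm
  have hroot : ∀ j, P.eval (c j) = 0 := fun j => by
    rw [hP, eval_prod]
    exact Finset.prod_eq_zero (Finset.mem_univ j) (by simp)
  have hlt : (D - C (D.coeff n) * P).degree < (Finset.univ : Finset (Fin n)).card := by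
    rw [Finset.card_univ, Fintype.card_fin, degree_lt_iff_coeff_zero]
    intro m hm
    rcases hm.eq_or_lt with rfl | hm
    · simp [hPc]
    · rw [coeff_sub, coeff_C_mul, coeff_eq_zero_of_natDegree_lt (hD.trans_lt hm),
        coeff_eq_zero_of_natDegree_lt (hPd.trans_lt hm)]
      simp
  have h := Lagrange.eq_interpolate (v := c) hc.injOn hlt
  rw [Lagrange.interpolate_eq_sum] at h
  simp only [eval_sub, eval_mul, hroot, mul_zero, sub_zero] at h
  rw [← h]
  ring

section Gaps

variable {n : ℕ} {a b c : Fin n → ℝ}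

lemma sub_mul_sub_pos_of_mem_gaps (hsep : ∀ j k : Fin n, j < k → b k < a j) {j k : Fin n}
    (hjk : j ≠ k) {x y z : ℝ} (hx : x ∈ Set.Icc (a k) (b k)) (hy : y ∈ Set.Icc (a k) (b k))
    (hz : z ∈ Set.Icc (a j) (b j)) : 0 < (x - z) * (y - z) := by
  rcases lt_or_gt_of_ne hjk with h | h
  · have := hsep j k h
    exact mul_pos_of_neg_of_neg (by linarith [hx.2, hz.1]) (by linarith [hy.2, hz.1])
  · have := hsep k j h
    exact mul_pos (by linarith [hx.1, hz.2]) (by linarith [hy.1, hz.2])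

lemma injective_of_mem_gaps (hsep : ∀ j k : Fin n, j < k → b k < a j)
    (hc : ∀ j, c j ∈ Set.Icc (a j) (b j)) : Function.Injective c := by
  intro j k h
  by_contra hjk
  have := sub_mul_sub_pos_of_mem_gaps hsep hjk (hc k) (hc k) (hc j)
  simp [h] at this

lemma prod_sub_mul_prod_sub_pos (hsep : ∀ j k : Fin n, j < k → b k < a j)
    (hc : ∀ j, c j ∈ Set.Icc (a j) (b j)) (z : Fin n → ℝ)
    (hz : ∀ j, z j ∈ Set.Icc (a j) (b j)) {k : Fin n} {s : Finset (Fin n)} (hs : k ∉ s) {x : ℝ}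
    (hx : x ∈ Set.Icc (a k) (b k)) :
    0 < (∏ i ∈ s, (c k - c i)) * ∏ i ∈ s, (x - z i) := by
  rw [← Finset.prod_mul_distrib]
  refine Finset.prod_pos fun i hi => ?_
  have hik : i ≠ k := fun h => hs (h ▸ hi)
  rcases lt_or_gt_of_ne hik with h | h
  · have := hsep i k h
    exact mul_pos_of_neg_of_neg (by linarith [(hc k).2, (hc i).1])
      (by linarith [hx.2, (hz i).1])
  · have := hsep k i h
    exact mul_pos (by linarith [(hc k).1, (hc i).2]) (by linarith [hx.1, (hz i).2])

lemma functional_prod_erase_nonpos (hsep : ∀ j k : Fin n, j < k → b k < a j)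
    (hc : ∀ j, c j ∈ Set.Ioo (a j) (b j)) {j k : Fin n} (hjk : j ≠ k) {L : ℝ[X] →ₗ[ℝ] ℝ}
    (hL : ∀ D : ℝ[X], D ≠ 0 → (∀ x ∈ Set.Ioo (a k) (b k), 0 ≤ D.eval x) → 0 < L D)
    (hLP : L (∏ i, (X - C (c i))) = 0) :
    L (C (∏ i ∈ Finset.univ.erase k, (c k - c i)) *
      ∏ i ∈ Finset.univ.erase j, (X - C (c i))) ≤ 0 := by
  have hc' : ∀ j, c j ∈ Set.Icc (a j) (b j) := fun j => Set.Ioo_subset_Icc_self (hc j)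
  set s : Finset (Fin n) := (Finset.univ.erase k).erase j with hs
  have hks : k ∉ s := by simp [hs]
  have hj : j ∈ Finset.univ.erase k := by simp [hjk]
  have hk : k ∈ Finset.univ.erase j := by simp [hjk.symm]
  have hs' : (Finset.univ.erase j).erase k = s := Finset.erase_right_comm
  have hpos : ∀ x ∈ Set.Icc (a k) (b k),
      0 < (∏ i ∈ s, (c k - c i)) * ∏ i ∈ s, (x - c i) := fun x hx =>
    prod_sub_mul_prod_sub_pos hsep hc' c hc' hks hx
  set E : ℝ[X] := C (∏ i ∈ s, (c k - c i)) * ∏ i ∈ s, (X - C (c i)) with hE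
  have hEe : ∀ x, E.eval x = (∏ i ∈ s, (c k - c i)) * ∏ i ∈ s, (x - c i) := by
    intro x
    simp [hE, eval_prod]
  have hE0 : E ≠ 0 := by
    intro h
    have := hpos (c k) (hc' k)
    rw [← hEe, h] at this
    simp at this
  have hLE : 0 < L ((X - C (c k)) ^ 2 * E) := by
    refine hL _ (mul_ne_zero (pow_ne_zero _ (X_sub_C_ne_zero _)) hE0) fun x hx => ?_
    rw [eval_mul, eval_pow, hEe]
    exact mul_nonneg (sq_nonneg _) (hpos x (Set.Ioo_subset_Icc_self hx)).le
  have hid : C (∏ i ∈ Finset.univ.erase k, (c k - c i)) *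
      ∏ i ∈ Finset.univ.erase j, (X - C (c i)) =
      (∏ i ∈ s, (c k - c i)) • (∏ i, (X - C (c i))) - (X - C (c k)) ^ 2 * E := by
    rw [← Finset.mul_prod_erase _ _ hj, ← Finset.mul_prod_erase _ _ hk,
      ← Finset.mul_prod_erase _ _ (Finset.mem_univ k), ← Finset.mul_prod_erase _ _ hj, hs', ← hs,
      hE, smul_eq_C_mul]
    simp only [C_mul, C_sub]
    ring
  rw [hid, map_sub, map_smul, hLP, smul_zero, zero_sub]
  linarith

/-- A polynomial of degree at most `n` whose signed gap integrals are all positive has positive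
coefficients in the Lagrange basis at the points `c j`. -/
lemma eval_div_prod_pos (hsep : ∀ j k : Fin n, j < k → b k < a j)
    (hc : ∀ j, c j ∈ Set.Ioo (a j) (b j)) {L : Fin n → ℝ[X] →ₗ[ℝ] ℝ}
    (hL : ∀ k, ∀ D : ℝ[X], D ≠ 0 → (∀ x ∈ Set.Ioo (a k) (b k), 0 ≤ D.eval x) → 0 < L k D)
    (hLP : ∀ k, L k (∏ i, (X - C (c i))) = 0) {H : ℝ[X]} (hHd : H.natDegree ≤ n)
    (hH : ∀ k, ∀ x ∈ Set.Ioo (a k) (b k),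
      0 < (∏ i ∈ Finset.univ.erase k, (c k - c i)) * H.eval x)
    {D : ℝ[X]} (hD : D.natDegree ≤ n)
    (hLD : ∀ k, 0 < L k (C (∏ i ∈ Finset.univ.erase k, (c k - c i)) * D)) (j : Fin n) :
    0 < D.eval (c j) / ∏ i ∈ Finset.univ.erase j, (c j - c i) := by
  have hinj : Function.Injective c :=
    injective_of_mem_gaps hsep fun j => Set.Ioo_subset_Icc_self (hc j)
  have hsum : ∀ F : ℝ[X], F.natDegree ≤ n → ∀ k,
      ∑ j, L k (C (∏ i ∈ Finset.univ.erase k, (c k - c i)) *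
        ∏ i ∈ Finset.univ.erase j, (X - C (c i))) *
          (F.eval (c j) / ∏ i ∈ Finset.univ.erase j, (c j - c i)) =
      L k (C (∏ i ∈ Finset.univ.erase k, (c k - c i)) * F) := by
    intro F hF k
    conv_rhs => rw [eq_C_mul_prod_add_sum hinj hF]
    simp only [← smul_eq_C_mul, smul_add, map_add, map_smul, map_sum, hLP, smul_eq_mul, mul_zero,
      zero_add, Finset.mul_sum]
    exact Finset.sum_congr rfl fun j _ => by ring
  refine pos_of_offDiag_nonpos
    (fun k j => L k (C (∏ i ∈ Finset.univ.erase k, (c k - c i)) *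
      ∏ i ∈ Finset.univ.erase j, (X - C (c i))))
    (fun k j hjk => functional_prod_erase_nonpos hsep hc hjk (hL k) (hLP k))
    (fun j => H.eval (c j) / ∏ i ∈ Finset.univ.erase j, (c j - c i)) ?_ ?_
    (fun j => D.eval (c j) / ∏ i ∈ Finset.univ.erase j, (c j - c i)) ?_ j
  · intro j
    exact div_pos_iff.2 ((mul_pos_iff.1 (hH j (c j) (hc j))).imp And.symm And.symm)
  · intro k
    rw [hsum H hHd]
    refine hL k _ ?_ fun x hx => ?_
    · intro h
      have := hH k (c k) (hc k)
      rw [← eval_C_mul, h] at this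
      simp at this
    · rw [eval_C_mul]
      exact (hH k x hx).le
  · intro k
    rw [hsum D hD]
    exact hLD k

lemma functional_C_mul_X_mul_prod_pos (hsep : ∀ j k : Fin n, j < k → b k < a j)
    (hc : ∀ j, c j ∈ Set.Ioo (a j) (b j)) {k : Fin n} {L : ℝ[X] →ₗ[ℝ] ℝ}
    (hL : ∀ D : ℝ[X], D ≠ 0 → (∀ x ∈ Set.Ioo (a k) (b k), 0 ≤ D.eval x) → 0 < L D)
    (hLP : L (∏ i, (X - C (c i))) = 0) :
    0 < L (C (∏ i ∈ Finset.univ.erase k, (c k - c i)) * (X * ∏ i, (X - C (c i)))) := by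
  have hc' : ∀ j, c j ∈ Set.Icc (a j) (b j) := fun j => Set.Ioo_subset_Icc_self (hc j)
  set p := ∏ i ∈ Finset.univ.erase k, (c k - c i) with hp
  set R : ℝ[X] := ∏ i ∈ Finset.univ.erase k, (X - C (c i)) with hR
  have hpos : ∀ x ∈ Set.Icc (a k) (b k), 0 < p * R.eval x := by
    intro x hx
    have := prod_sub_mul_prod_sub_pos hsep hc' c hc' (Finset.notMem_erase k Finset.univ) hx
    simpa [hR, eval_prod] using this
  have hid : C p * (X * ∏ i, (X - C (c i))) =
      (X - C (c k)) ^ 2 * (C p * R) + (p * c k) • ∏ i, (X - C (c i)) := by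
    rw [← Finset.mul_prod_erase _ _ (Finset.mem_univ k), ← hR, smul_eq_C_mul, C_mul]
    ring
  rw [hid, map_add, map_smul, hLP, smul_zero, add_zero]
  refine hL _ (mul_ne_zero (pow_ne_zero _ (X_sub_C_ne_zero _)) ?_) fun x hx => ?_
  · intro h
    have := hpos (c k) (hc' k)
    rw [← eval_C_mul, h] at this
    simp at this
  · rw [eval_mul, eval_pow, eval_C_mul]
    exact mul_nonneg (sq_nonneg _) (hpos x (Set.Ioo_subset_Icc_self hx)).le

end Gaps

/-- inequality (4.21): If moreover `P(x) = ∏ (x - c_j)` with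
`c_j ∈ (a_j, b_j)` and `Q(c_j) ≠ 0`, and `T₁(x) = ∏ (x-a_j)(x-b_j)`, then
`1 < ∑_j T₁(c_j) / (P'(c_j) Q(c_j))`. -/
theorem stmt_7 (n : ℕ) (hn : 1 ≤ n) (a b : Fin n → ℝ)
    (ha0 : ∀ j, 0 < a j) (hab : ∀ j, a j < b j)
    (hsep : ∀ j k : Fin n, j < k → b k < a j)
    (T : Polynomial ℝ) (hT : T = X * ∏ j, (X - C (a j)) * (X - C (b j)))
    (P : Polynomial ℝ) (hPmonic : P.Monic) (hPdeg : P.natDegree = n)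
    (hPint : ∀ k, ∫ x in (a k)..(b k), P.eval x / Real.sqrt (-(T.eval x)) = 0)
    (P1 : Polynomial ℝ) (hP1monic : P1.Monic) (hP1deg : P1.natDegree = n)
    (Q : Polynomial ℝ) (hQ : Q = X * P1)
    (hQint : ∀ k, ∫ x in (a k)..(b k), Q.eval x / Real.sqrt (-(T.eval x)) = 0)
    (c : Fin n → ℝ) (hc : ∀ j, c j ∈ Set.Ioo (a j) (b j))
    (hP : P = ∏ j, (X - C (c j))) (hQc : ∀ j, Q.eval (c j) ≠ 0)
    (T₁ : Polynomial ℝ) (hT₁ : T₁ = ∏ j, (X - C (a j)) * (X - C (b j))) :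
    1 < ∑ j, T₁.eval (c j) / ((derivative P).eval (c j) * Q.eval (c j)) := by
  obtain ⟨m, rfl⟩ : ∃ m, n = m + 1 := ⟨n - 1, by omega⟩
  have hc' : ∀ j, c j ∈ Set.Icc (a j) (b j) := fun j => Set.Ioo_subset_Icc_self (hc j)
  have haI : ∀ j, a j ∈ Set.Icc (a j) (b j) := fun j => Set.left_mem_Icc.2 (hab j).le
  have hbI : ∀ j, b j ∈ Set.Icc (a j) (b j) := fun j => Set.right_mem_Icc.2 (hab j).le
  have hinj : Function.Injective c := injective_of_mem_gaps hsep hc'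
  have hL : ∀ k, ∃ L : ℝ[X] →ₗ[ℝ] ℝ,
      (∀ D, L D = ∫ x in (a k)..(b k), D.eval x / Real.sqrt (-(T.eval x))) ∧
      ∀ D : ℝ[X], D ≠ 0 → (∀ x ∈ Set.Ioo (a k) (b k), 0 ≤ D.eval x) → 0 < L D := by
    intro k
    refine exists_gap_functional (hab k)
      (K := X * ∏ j ∈ Finset.univ.erase k, (X - C (a j)) * (X - C (b j))) ?_ fun x hx => ?_
    · rw [hT, ← Finset.mul_prod_erase _ _ (Finset.mem_univ k)]
      ring
    · simp only [eval_mul, eval_X, eval_prod, eval_sub, eval_C]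
      refine mul_pos ((ha0 k).trans_le hx.1) (Finset.prod_pos fun j hj => ?_)
      rcases lt_or_gt_of_ne (Finset.ne_of_mem_erase hj) with h | h
      · have := hsep j k h
        exact mul_pos_of_neg_of_neg (by linarith [hx.2]) (by linarith [hx.2, hab j])
      · have := hsep k j h
        exact mul_pos (by linarith [hx.1, hab j]) (by linarith [hx.1])
  choose L hLi hLpos using hL
  have hLP : ∀ k, L k (∏ i, (X - C (c i))) = 0 := fun k => by rw [← hP, hLi, hPint]
  have hLQ : ∀ k, L k Q = 0 := fun k => by rw [hLi, hQint]
  set p : Fin (m + 1) → ℝ := fun k => ∏ i ∈ Finset.univ.erase k, (c k - c i) with hp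
  have hp0 : ∀ k, p k ≠ 0 := fun k => Finset.prod_ne_zero_iff.2 fun i hi =>
    sub_ne_zero.2 fun h => Finset.ne_of_mem_erase hi (hinj h).symm
  have hPp : ∀ k, (derivative P).eval (c k) = p k := by
    intro k
    have := Lagrange.eval_nodal_derivative_eval_node_eq (v := c) (Finset.mem_univ k)
    rw [Lagrange.nodal_eq, Lagrange.eval_nodal] at this
    rw [hP, this]
  set H : ℝ[X] := ∏ i ∈ Finset.univ.erase 0, (X - C (b i)) with hH
  set S : ℝ[X] := (X - C (b 0)) * ∏ i, (X - C (a i)) with hS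
  have hHm : H.Monic := monic_prod_of_monic _ _ fun j _ => monic_X_sub_C _
  have hHd : H.natDegree = m := by simp [hH, natDegree_prod_of_monic, monic_X_sub_C]
  have hAm : (∏ i, (X - C (a i))).Monic := monic_prod_of_monic _ _ fun j _ => monic_X_sub_C _
  have hAd : (∏ i, (X - C (a i))).natDegree = m + 1 := by
    simp [natDegree_prod_of_monic, monic_X_sub_C]
  have hSm : S.Monic := (monic_X_sub_C _).mul hAm
  have hSd : S.natDegree = m + 2 := by
    rw [hS, (monic_X_sub_C _).natDegree_mul hAm, hAd, natDegree_X_sub_C]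
    ring
  have hQm : Q.Monic := by rw [hQ]; exact monic_X.mul hP1monic
  have hQd : Q.natDegree = m + 2 := by
    rw [hQ, monic_X.natDegree_mul hP1monic, hP1deg, natDegree_X]
    ring
  have hXPm : (X * P).Monic := monic_X.mul hPmonic
  have hXPd : (X * P).natDegree = m + 2 := by
    rw [monic_X.natDegree_mul hPmonic, hPdeg, natDegree_X]
    ring
  have hT₁SH : T₁ = S * H := by
    rw [hT₁, Finset.prod_mul_distrib, hS, hH,
      ← Finset.mul_prod_erase _ (fun i => X - C (b i)) (Finset.mem_univ 0)]
    ring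
  have hb0 : ∀ k, ∀ x ∈ Set.Ioo (a k) (b k), x - b 0 < 0 := by
    intro k x hx
    rcases (Fin.zero_le k).eq_or_lt with rfl | h
    · linarith [hx.2]
    · linarith [hx.2, hsep 0 k h, hab 0]
  have hpS : ∀ k, ∀ x ∈ Set.Ioo (a k) (b k), p k * S.eval x < 0 := by
    intro k x hx
    have h := prod_sub_mul_prod_sub_pos hsep hc' a haI (Finset.notMem_erase k Finset.univ)
      (Set.Ioo_subset_Icc_self hx)
    have hS' : p k * S.eval x =
        ((x - b 0) * (x - a k)) * (p k * ∏ i ∈ Finset.univ.erase k, (x - a i)) := by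
      simp only [hS, eval_mul, eval_prod, eval_sub, eval_X, eval_C]
      rw [← Finset.mul_prod_erase _ _ (Finset.mem_univ k)]
      ring
    rw [hS']
    exact mul_neg_of_neg_of_pos
      (mul_neg_of_neg_of_pos (hb0 k x hx) (by linarith [hx.1])) h
  have hpH : ∀ k, ∀ x ∈ Set.Ioo (a k) (b k), 0 < p k * H.eval x := by
    intro k x hx
    have h := prod_sub_mul_prod_sub_pos hsep hc' b hbI (Finset.notMem_erase k Finset.univ)
      (Set.Ioo_subset_Icc_self hx)
    have hH' : (x - b 0) * (p k * H.eval x) =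
        (x - b k) * (p k * ∏ i ∈ Finset.univ.erase k, (x - b i)) := by
      have h0 := Finset.mul_prod_erase _ (fun i => x - b i) (Finset.mem_univ (0 : Fin (m + 1)))
      have hk := Finset.mul_prod_erase _ (fun i => x - b i) (Finset.mem_univ k)
      simp only [hH, eval_prod, eval_sub, eval_X, eval_C]
      linear_combination p k * (h0 - hk)
    have hneg : (x - b 0) * (p k * H.eval x) < 0 := by
      rw [hH']
      exact mul_neg_of_neg_of_pos (by linarith [hx.2]) h
    exact pos_of_mul_neg_right hneg (hb0 k x hx).le
  have hdeg : ∀ F G : ℝ[X], F.Monic → G.Monic → F.natDegree = m + 2 → G.natDegree = m + 2 →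
      (F - G).natDegree ≤ m + 1 := by
    intro F G hF hG hFd hGd
    rw [natDegree_le_iff_coeff_eq_zero]
    intro N hN
    rcases (Nat.succ_le_of_lt hN).eq_or_lt with h | h
    · have h1 : F.coeff N = 1 := by rw [← h, ← hF.coeff_natDegree, hFd]
      have h2 : G.coeff N = 1 := by rw [← h, ← hG.coeff_natDegree, hGd]
      rw [coeff_sub, h1, h2, sub_self]
    · rw [coeff_sub, coeff_eq_zero_of_natDegree_lt (by omega),
        coeff_eq_zero_of_natDegree_lt (by omega), sub_self]
  have hPc : ∀ j, P.eval (c j) = 0 := fun j => by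
    rw [hP, eval_prod]
    exact Finset.prod_eq_zero (Finset.mem_univ j) (by simp)
  have hQneg : ∀ j, Q.eval (c j) / p j < 0 := by
    intro j
    have h := eval_div_prod_pos hsep hc hLpos hLP (hHd.trans_le (Nat.le_succ m)) hpH
      (hdeg _ _ hXPm hQm hXPd hQd) (fun k => ?_) j
    · rw [eval_sub, eval_mul, hPc, mul_zero, zero_sub, neg_div] at h
      exact neg_pos.1 h
    · have h := functional_C_mul_X_mul_prod_pos hsep hc (hLpos k) (hLP k)
      rw [← hP] at h
      rwa [mul_sub, map_sub, ← smul_eq_C_mul (p := Q), map_smul, hLQ, smul_zero, sub_zero]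
  have hSQ : ∀ j, S.eval (c j) / p j < Q.eval (c j) / p j := by
    intro j
    have h := eval_div_prod_pos hsep hc hLpos hLP (hHd.trans_le (Nat.le_succ m)) hpH
      (hdeg _ _ hQm hSm hQd hSd) (fun k => ?_) j
    · rw [eval_sub, sub_div] at h
      exact sub_pos.1 h
    · have h : 0 < L k (-(C (p k) * S)) := by
        refine hLpos k _ (neg_ne_zero.2 (mul_ne_zero (C_ne_zero.2 (hp0 k)) hSm.ne_zero))
          fun x hx => ?_
        rw [eval_neg, eval_C_mul]
        exact (neg_pos.2 (hpS k x hx)).le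
      rw [mul_sub, map_sub, ← smul_eq_C_mul (p := Q), map_smul, hLQ, smul_zero, zero_sub]
      rwa [map_neg] at h
  have hone : ∑ j, H.eval (c j) / p j = 1 := by
    have h := Lagrange.leadingCoeff_eq_sum (s := Finset.univ) (v := c) hinj.injOn (P := H)
      (by rw [degree_eq_natDegree hHm.ne_zero, hHd]; simp)
    rw [hHm.leadingCoeff] at h
    exact h.symm
  rw [← hone]
  refine Finset.sum_lt_sum_of_nonempty Finset.univ_nonempty fun j _ => ?_
  rw [hPp, hT₁SH, eval_mul]
  have hHpos : 0 < H.eval (c j) / p j :=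
    div_pos_iff.2 ((mul_pos_iff.1 (hpH j (c j) (hc j))).imp And.symm And.symm)
  have hratio : 1 < (S.eval (c j) / p j) / (Q.eval (c j) / p j) :=
    (one_lt_div_of_neg (hQneg j)).2 (hSQ j)
  have heq : S.eval (c j) * H.eval (c j) / (p j * Q.eval (c j)) =
      (S.eval (c j) / p j) / (Q.eval (c j) / p j) * (H.eval (c j) / p j) := by
    have h1 := hp0 j
    have h2 := hQc j
    field_simp
  rw [heq]
  exact lt_mul_of_one_lt_left hHpos hratio
end
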